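/- arXiv:2512.13305 — 2 statements merged into one kernel-verified Lean document; each statement's English description precedes it below -/
import Mathlib

section
/- Assume the Bressan–Constantin differential relations (see context) and suppose W(ξ₄) = π and W′(ξ₄) = 0 at some point ξ₄ ∈ ℝ. Then U′(ξ₄) = U″(ξ₄) = 0; ∂^j V(ξ₄) = 0 for j = 1, 2, 3, 4; U‴(ξ₄) = −(1/2) q(ξ₄) W″(ξ₄) cos²(Z(ξ₄)/2); ∂^5 V(ξ₄) = (3/4) q(ξ₄) W″(ξ₄)² sin(Z(ξ₄)); ∂^i y(ξ₄) = 0 for i = 1, 2, 3, 4; and ∂^5 y(ξ₄) = (3/2) q(ξ₄) W″(ξ₄)² cos²(Z(ξ₄)/2). -/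
open Real

lemma aux_mul {f g : ℝ → ℝ} (hf : ContDiff ℝ (⊤ : ℕ∞) f) (hg : ContDiff ℝ (⊤ : ℕ∞) g) (n : ℕ) (x : ℝ) :
    iteratedDeriv n (fun t => f t * g t) x = ∑ i ∈ Finset.range (n + 1),
      (n.choose i : ℝ) * iteratedDeriv i f x * iteratedDeriv (n - i) g x := by
  have hn : ((n : ℕ) : WithTop ℕ∞) ≤ ((⊤ : ℕ∞) : WithTop ℕ∞) := by
    exact_mod_cast le_top
  exact iteratedDeriv_fun_mul (hf.contDiffAt.of_le hn) (hg.contDiffAt.of_le hn)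

lemma aux_sq {c g : ℝ → ℝ} (hc : ContDiff ℝ (⊤ : ℕ∞) c) (hg : ContDiff ℝ (⊤ : ℕ∞) g) (x : ℝ)
    (h0 : c x = 0) (h1 : iteratedDeriv 1 c x = 0) :
    (∀ j : ℕ, j ≤ 3 → iteratedDeriv j (fun t => c t * c t * g t) x = 0) ∧
    iteratedDeriv 4 (fun t => c t * c t * g t) x = 6 * iteratedDeriv 2 c x ^ 2 * g x := by
  have hcc : ContDiff ℝ (⊤ : ℕ∞) (fun t => c t * c t) := hc.mul hc
  have h0' : iteratedDeriv 0 c x = 0 := by simpa using h0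
  have key : ∀ j : ℕ, j ≤ 3 → iteratedDeriv j (fun t => c t * c t) x = 0 := by
    intro j hj
    rw [aux_mul hc hc]
    interval_cases j <;> simp only [Finset.sum_range_succ, Finset.sum_range_zero, h0', h1, Nat.sub_self, Nat.reduceSub, mul_zero, zero_mul, add_zero]
  have key4 : iteratedDeriv 4 (fun t => c t * c t) x = 6 * iteratedDeriv 2 c x ^ 2 := by
    rw [aux_mul hc hc]
    simp only [Finset.sum_range_succ, Finset.sum_range_zero, h0', h1, Nat.sub_self, Nat.reduceSub, mul_zero, zero_mul, add_zero, zero_add]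
    norm_num [Nat.choose]
    ring
  constructor
  · intro j hj
    rw [aux_mul hcc hg]
    apply Finset.sum_eq_zero
    intro i hi
    rw [key i (by have := Finset.mem_range.1 hi; omega)]
    ring
  · rw [aux_mul hcc hg, Finset.sum_range_succ, Finset.sum_eq_zero, key4]
    · simp
    · intro i hi
      rw [key i (by have := Finset.mem_range.1 hi; omega)]
      ring

lemma aux_d {W : ℝ → ℝ} (hW : ContDiff ℝ (⊤ : ℕ∞) W) :
    Differentiable ℝ W ∧ Differentiable ℝ (deriv W) := by
  refine ⟨hW.differentiable (by simp), ?_⟩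
  have := hW.differentiable_iteratedDeriv 1 (by exact_mod_cast ENat.coe_lt_top 1)
  simpa [iteratedDeriv_one] using this

lemma aux_cos {W : ℝ → ℝ} (hW : ContDiff ℝ (⊤ : ℕ∞) W) (x : ℝ) (h0 : W x = π) (h1 : deriv W x = 0) :
    Real.cos (W x / 2) = 0 ∧ iteratedDeriv 1 (fun t => Real.cos (W t / 2)) x = 0 ∧
    iteratedDeriv 2 (fun t => Real.cos (W t / 2)) x = - iteratedDeriv 2 W x / 2 := by
  obtain ⟨d0, d1⟩ := aux_d hW
  have e : deriv (fun t => Real.cos (W t / 2)) = fun t => -Real.sin (W t / 2) * (deriv W t / 2) := by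
    funext t
    exact (((d0 t).hasDerivAt.div_const 2).cos).deriv
  refine ⟨by rw [h0]; exact Real.cos_pi_div_two, ?_, ?_⟩
  · rw [iteratedDeriv_one, e]; simp [h1]
  · rw [iteratedDeriv_succ', e, iteratedDeriv_one, iteratedDeriv_succ', iteratedDeriv_one]
    have := ((((d0 x).hasDerivAt.div_const 2).sin).neg.mul ((d1 x).hasDerivAt.div_const 2)).deriv
    refine Eq.trans this ?_
    simp [h0, h1]
    ring

lemma aux_sin {W : ℝ → ℝ} (hW : ContDiff ℝ (⊤ : ℕ∞) W) (x : ℝ) (h0 : W x = π) (h1 : deriv W x = 0) :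
    Real.sin (W x) = 0 ∧ iteratedDeriv 1 (fun t => Real.sin (W t)) x = 0 ∧
    iteratedDeriv 2 (fun t => Real.sin (W t)) x = - iteratedDeriv 2 W x := by
  obtain ⟨d0, d1⟩ := aux_d hW
  have e : deriv (fun t => Real.sin (W t)) = fun t => Real.cos (W t) * deriv W t := by
    funext t
    exact ((d0 t).hasDerivAt.sin).deriv
  refine ⟨by rw [h0]; exact Real.sin_pi, ?_, ?_⟩
  · rw [iteratedDeriv_one, e]; simp [h1]
  · rw [iteratedDeriv_succ', e, iteratedDeriv_one, iteratedDeriv_succ', iteratedDeriv_one]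
    have := (((d0 x).hasDerivAt.cos).mul (d1 x).hasDerivAt).deriv
    refine Eq.trans this ?_
    simp [h0, h1]

/-- Case (4) of the proof of Theorem 1.2: at a point `ξ₄` with
`W ξ₄ = π` and `W′ ξ₄ = 0`:
`U′ = U″ = 0`, `∂^j V = 0` for `j = 1,…,4`,
`U‴ = -(1/2) q W″ cos²(Z/2)`, `∂^5 V = (3/4) q (W″)² sin Z`,
`∂^i y = 0` for `i = 1,…,4`, and `∂^5 y = (3/2) q (W″)² cos²(Z/2)` at `ξ₄`. -/
theorem stmt10 (q W Z U V y : ℝ → ℝ)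
    (hq : ContDiff ℝ (⊤ : ℕ∞) q) (hW : ContDiff ℝ (⊤ : ℕ∞) W) (hZ : ContDiff ℝ (⊤ : ℕ∞) Z)
    (hy : ∀ ξ, deriv y ξ = q ξ * Real.cos (W ξ / 2) ^ 2 * Real.cos (Z ξ / 2) ^ 2)
    (hU : ∀ ξ, deriv U ξ = q ξ / 2 * Real.sin (W ξ) * Real.cos (Z ξ / 2) ^ 2)
    (hV : ∀ ξ, deriv V ξ = q ξ / 2 * Real.cos (W ξ / 2) ^ 2 * Real.sin (Z ξ))
    (ξ₄ : ℝ) (hWπ : W ξ₄ = π) (hW' : deriv W ξ₄ = 0) :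
    iteratedDeriv 1 U ξ₄ = 0 ∧ iteratedDeriv 2 U ξ₄ = 0 ∧
    (∀ j : ℕ, 1 ≤ j → j ≤ 4 → iteratedDeriv j V ξ₄ = 0) ∧
    iteratedDeriv 3 U ξ₄
      = -(1 / 2) * q ξ₄ * iteratedDeriv 2 W ξ₄ * Real.cos (Z ξ₄ / 2) ^ 2 ∧
    iteratedDeriv 5 V ξ₄
      = (3 / 4) * q ξ₄ * (iteratedDeriv 2 W ξ₄) ^ 2 * Real.sin (Z ξ₄) ∧
    (∀ i : ℕ, 1 ≤ i → i ≤ 4 → iteratedDeriv i y ξ₄ = 0) ∧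
    iteratedDeriv 5 y ξ₄
      = (3 / 2) * q ξ₄ * (iteratedDeriv 2 W ξ₄) ^ 2 * Real.cos (Z ξ₄ / 2) ^ 2 := by
  obtain ⟨c0, c1, c2⟩ := aux_cos hW ξ₄ hWπ hW'
  obtain ⟨s0, s1, s2⟩ := aux_sin hW ξ₄ hWπ hW'
  have hc : ContDiff ℝ (⊤ : ℕ∞) (fun t => Real.cos (W t / 2)) := (hW.div_const 2).cos
  have hs : ContDiff ℝ (⊤ : ℕ∞) (fun t => Real.sin (W t)) := hW.sin
  have hz : ContDiff ℝ (⊤ : ℕ∞) (fun t => Real.cos (Z t / 2) ^ 2) := ((hZ.div_const 2).cos).pow 2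
  have gy : ContDiff ℝ (⊤ : ℕ∞) (fun t => q t * Real.cos (Z t / 2) ^ 2) := hq.mul hz
  have gU : ContDiff ℝ (⊤ : ℕ∞) (fun t => q t / 2 * Real.cos (Z t / 2) ^ 2) :=
    (hq.div_const 2).mul hz
  have gV : ContDiff ℝ (⊤ : ℕ∞) (fun t => q t / 2 * Real.sin (Z t)) :=
    (hq.div_const 2).mul hZ.sin
  have ey : deriv y = fun t => Real.cos (W t / 2) * Real.cos (W t / 2) *
      (q t * Real.cos (Z t / 2) ^ 2) := by
    funext t; rw [hy]; ring
  have eV : deriv V = fun t => Real.cos (W t / 2) * Real.cos (W t / 2) *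
      (q t / 2 * Real.sin (Z t)) := by
    funext t; rw [hV]; ring
  have eU : deriv U = fun t => Real.sin (W t) * (q t / 2 * Real.cos (Z t / 2) ^ 2) := by
    funext t; rw [hU]; ring
  obtain ⟨y0, y4⟩ := aux_sq hc gy ξ₄ c0 c1
  obtain ⟨v0, v4⟩ := aux_sq hc gV ξ₄ c0 c1
  rw [← ey] at y4
  rw [← eV] at v4
  rw [← ey] at y0
  rw [← eV] at v0
  have s0' : iteratedDeriv 0 (fun t => Real.sin (W t)) ξ₄ = 0 := by simpa using s0
  refine ⟨?_, ?_, ?_, ?_, ?_, ?_, ?_⟩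
  · rw [iteratedDeriv_one, eU]; simp [s0]
  · rw [iteratedDeriv_succ', eU, aux_mul hs gU]
    simp only [Finset.sum_range_succ, Finset.sum_range_zero, s0', s1, mul_zero, zero_mul, add_zero]
  · intro j h1 h4
    obtain ⟨k, rfl⟩ := Nat.exists_eq_add_of_le' h1
    rw [iteratedDeriv_succ']
    exact v0 k (by omega)
  · rw [iteratedDeriv_succ', eU, aux_mul hs gU]
    simp only [Finset.sum_range_succ, Finset.sum_range_zero, s0', s1, s2, mul_zero, zero_mul, add_zero, zero_add, Nat.sub_self, iteratedDeriv_zero, Nat.choose_self]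
    push_cast
    ring
  · rw [iteratedDeriv_succ', v4, c2]; ring
  · intro j h1 h4
    obtain ⟨k, rfl⟩ := Nat.exists_eq_add_of_le' h1
    rw [iteratedDeriv_succ']
    exact y0 k (by omega)
  · rw [iteratedDeriv_succ', y4, c2]; ring
end

section
/- Assume the Bressan–Constantin differential relations (see context) and suppose W(ξ₆) = π, W′(ξ₆) = 0, and Z(ξ₆) = π at some point ξ₆ ∈ ℝ. Then ∂^i U(ξ₆) = 0 for i = 1, …, 4; ∂^j V(ξ₆) = 0 for j = 1, …, 5; ∂^5 U(ξ₆) = −(3/2) q(ξ₆) W″(ξ₆) Z′(ξ₆)²; ∂^6 V(ξ₆) = −(15/4) q(ξ₆) W″(ξ₆)² Z′(ξ₆); ∂^i y(ξ₆) = 0 for i = 1, …, 6; and ∂^7 y(ξ₆) = (45/4) q(ξ₆) W″(ξ₆)² Z′(ξ₆)². -/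
open Real

/-- `f` is smooth and `f = c t ^ n + O(t ^ (n + 1))` at `x`. -/
def VanOrd (x : ℝ) (n : ℕ) (f : ℝ → ℝ) (c : ℝ) : Prop :=
  ContDiff ℝ (⊤ : ℕ∞) f ∧ (∀ i < n, iteratedDeriv i f x = 0) ∧
    iteratedDeriv n f x = c * (n.factorial : ℝ)

theorem VanOrd.mul {x : ℝ} {n m : ℕ} {f g : ℝ → ℝ} {a b : ℝ}
    (hf : VanOrd x n f a) (hg : VanOrd x m g b) :
    VanOrd x (n + m) (fun t => f t * g t) (a * b) := by
  obtain ⟨hf, hf0, hfn⟩ := hf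
  obtain ⟨hg, hg0, hgm⟩ := hg
  have L : ∀ k : ℕ, iteratedDeriv k (fun t => f t * g t) x = ∑ i ∈ Finset.range (k + 1),
      (k.choose i : ℝ) * iteratedDeriv i f x * iteratedDeriv (k - i) g x := by
    intro k
    exact iteratedDeriv_fun_mul (hf.contDiffAt.of_le (by exact_mod_cast le_top))
      (hg.contDiffAt.of_le (by exact_mod_cast le_top))
  refine ⟨hf.mul hg, ?_, ?_⟩
  · intro k hk
    rw [L]
    refine Finset.sum_eq_zero fun i hi => ?_
    rw [Finset.mem_range] at hi
    by_cases h : i < n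
    · rw [hf0 i h]; ring
    · rw [hg0 (k - i) (by omega)]; ring
  · rw [L, Finset.sum_eq_single n]
    · rw [hfn, Nat.add_sub_cancel_left, hgm]
      have := Nat.add_choose_mul_factorial_mul_factorial n m
      have h2 : ((n + m).choose n : ℝ) * n.factorial * m.factorial = (n + m).factorial := by
        rw [Nat.choose_symm_add]; exact_mod_cast this
      rw [← h2]; ring
    · intro i hi hne
      rw [Finset.mem_range] at hi
      by_cases h : i < n
      · rw [hf0 i h]; ring
      · rw [hg0 (n + m - i) (by omega)]; ring
    · intro h
      exact absurd (Finset.mem_range.2 (by omega)) h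

theorem VanOrd.concl {x : ℝ} {n : ℕ} {f F : ℝ → ℝ} {a : ℝ}
    (hf : VanOrd x n f a) (hF : ∀ t, deriv F t = f t) :
    (∀ i : ℕ, 1 ≤ i → i ≤ n → iteratedDeriv i F x = 0) ∧
      iteratedDeriv (n + 1) F x = a * (n.factorial : ℝ) := by
  have e : deriv F = f := funext hF
  constructor
  · intro i h1 h2
    obtain ⟨j, rfl⟩ : ∃ j, i = j + 1 := ⟨i - 1, by omega⟩
    rw [iteratedDeriv_succ', e]
    exact hf.2.1 j (by omega)
  · rw [iteratedDeriv_succ', e]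
    exact hf.2.2

theorem vanOrd_one {x : ℝ} {f : ℝ → ℝ} {c : ℝ} (hf : ContDiff ℝ (⊤ : ℕ∞) f)
    (h0 : f x = 0) (h1 : deriv f x = c) : VanOrd x 1 f c := by
  refine ⟨hf, ?_, ?_⟩
  · intro i hi
    obtain rfl : i = 0 := by omega
    simpa using h0
  · simpa [iteratedDeriv_one] using h1

theorem vanOrd_two {x : ℝ} {f f' : ℝ → ℝ} {c : ℝ} (hf : ContDiff ℝ (⊤ : ℕ∞) f)
    (h0 : f x = 0) (hd : ∀ t, HasDerivAt f (f' t) t) (h1 : f' x = 0)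
    (h2 : HasDerivAt f' (c * 2) x) : VanOrd x 2 f c := by
  have e : deriv f = f' := funext fun t => (hd t).deriv
  refine ⟨hf, ?_, ?_⟩
  · intro i hi
    interval_cases i
    · simpa using h0
    · simpa [iteratedDeriv_one, e] using h1
  · rw [iteratedDeriv_succ', e, iteratedDeriv_one, h2.deriv]
    norm_num [Nat.factorial]

/-- Case (6) of the proof of Theorem 1.2: at a point `ξ₆` with
`W ξ₆ = π`, `W′ ξ₆ = 0` and `Z ξ₆ = π`:
`∂^i U = 0` for `i = 1,…,4`, `∂^j V = 0` for `j = 1,…,5`,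
`∂^5 U = -(3/2) q W″ (Z′)²`, `∂^6 V = -(15/4) q (W″)² Z′`,
`∂^i y = 0` for `i = 1,…,6`, and `∂^7 y = (45/4) q (W″)² (Z′)²` at `ξ₆`. -/
theorem stmt12 (q W Z U V y : ℝ → ℝ)
    (hq : ContDiff ℝ (⊤ : ℕ∞) q) (hW : ContDiff ℝ (⊤ : ℕ∞) W) (hZ : ContDiff ℝ (⊤ : ℕ∞) Z)
    (hy : ∀ ξ, deriv y ξ = q ξ * Real.cos (W ξ / 2) ^ 2 * Real.cos (Z ξ / 2) ^ 2)
    (hU : ∀ ξ, deriv U ξ = q ξ / 2 * Real.sin (W ξ) * Real.cos (Z ξ / 2) ^ 2)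
    (hV : ∀ ξ, deriv V ξ = q ξ / 2 * Real.cos (W ξ / 2) ^ 2 * Real.sin (Z ξ))
    (ξ₆ : ℝ) (hWπ : W ξ₆ = π) (hW' : deriv W ξ₆ = 0) (hZπ : Z ξ₆ = π) :
    (∀ i : ℕ, 1 ≤ i → i ≤ 4 → iteratedDeriv i U ξ₆ = 0) ∧
    (∀ j : ℕ, 1 ≤ j → j ≤ 5 → iteratedDeriv j V ξ₆ = 0) ∧
    iteratedDeriv 5 U ξ₆
      = -(3 / 2) * q ξ₆ * iteratedDeriv 2 W ξ₆ * (deriv Z ξ₆) ^ 2 ∧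
    iteratedDeriv 6 V ξ₆
      = -(15 / 4) * q ξ₆ * (iteratedDeriv 2 W ξ₆) ^ 2 * deriv Z ξ₆ ∧
    (∀ i : ℕ, 1 ≤ i → i ≤ 6 → iteratedDeriv i y ξ₆ = 0) ∧
    iteratedDeriv 7 y ξ₆
      = (45 / 4) * q ξ₆ * (iteratedDeriv 2 W ξ₆) ^ 2 * (deriv Z ξ₆) ^ 2 := by
  have dW : ∀ t, HasDerivAt W (deriv W t) t := fun t =>
    ((hW.differentiable (by simp)) t).hasDerivAt
  have dZ : ∀ t, HasDerivAt Z (deriv Z t) t := fun t =>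
    ((hZ.differentiable (by simp)) t).hasDerivAt
  have hW1 : ContDiff ℝ (⊤ : ℕ∞) (deriv W) := by
    have := ContDiff.iterate_deriv 1 hW
    simpa using this
  have dW2 : HasDerivAt (deriv W) (iteratedDeriv 2 W ξ₆) ξ₆ := by
    rw [iteratedDeriv_succ', iteratedDeriv_one]
    exact ((hW1.differentiable (by simp)) ξ₆).hasDerivAt
  set w := iteratedDeriv 2 W ξ₆ with hw
  set z := deriv Z ξ₆ with hz
  have A : VanOrd ξ₆ 0 q (q ξ₆) := ⟨hq, by simp, by simp⟩
  have A2 : VanOrd ξ₆ 0 (fun t => q t / 2) (q ξ₆ / 2) :=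
    ⟨hq.div_const 2, by simp, by simp⟩
  have CZ : VanOrd ξ₆ 1 (fun t => Real.cos (Z t / 2)) (-z / 2) := by
    refine vanOrd_one (Real.contDiff_cos.comp (hZ.div_const 2)) (by simp [hZπ]) ?_
    rw [(((dZ ξ₆).div_const 2).cos).deriv, hZπ, Real.sin_pi_div_two]; ring
  have SZ : VanOrd ξ₆ 1 (fun t => Real.sin (Z t)) (-z) := by
    refine vanOrd_one (Real.contDiff_sin.comp hZ) (by simp [hZπ]) ?_
    rw [((dZ ξ₆).sin).deriv, hZπ, Real.cos_pi]; ring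
  have CW : VanOrd ξ₆ 2 (fun t => Real.cos (W t / 2)) (-w / 4) := by
    refine vanOrd_two (Real.contDiff_cos.comp (hW.div_const 2)) (by simp [hWπ])
      (fun t => ((dW t).div_const 2).cos) (by simp [hW']) ?_
    refine HasDerivAt.congr_deriv ((((dW ξ₆).div_const 2).sin.neg).mul (dW2.div_const 2)) ?_
    simp only [Pi.neg_apply, hWπ, hW', Real.sin_pi_div_two]; ring
  have SW : VanOrd ξ₆ 2 (fun t => Real.sin (W t)) (-w / 2) := by
    refine vanOrd_two (Real.contDiff_sin.comp hW) (by simp [hWπ])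
      (fun t => (dW t).sin) (by simp [hW']) ?_
    refine HasDerivAt.congr_deriv (((dW ξ₆).cos).mul dW2) ?_
    rw [hWπ, hW', Real.cos_pi]; ring
  obtain ⟨y1, y2⟩ := ((A.mul (CW.mul CW)).mul (CZ.mul CZ)).concl (F := y)
    (fun t => by rw [hy]; ring)
  obtain ⟨u1, u2⟩ := ((A2.mul SW).mul (CZ.mul CZ)).concl (F := U)
    (fun t => by rw [hU]; ring)
  obtain ⟨v1, v2⟩ := ((A2.mul (CW.mul CW)).mul SZ).concl (F := V)
    (fun t => by rw [hV]; ring)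
  norm_num [Nat.factorial] at y1 y2 u1 u2 v1 v2
  refine ⟨u1, v1, ?_, ?_, y1, ?_⟩
  · rw [u2]; ring
  · rw [v2]; ring
  · rw [y2]; ring
end
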